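/- (Hiai–Petz) Let ρ be a positive definite state on ℂ^d, and for each n let σ_n be a state on (ℂ^d)^{⊗n}. If the sequence (1/n)·D(σ_n ‖ ρ^{⊗n}) converges as n → ∞, then (1/n)·D(𝓔_{ρ^{⊗n}}(σ_n) ‖ ρ^{⊗n}) converges to the same limit, where 𝓔_{ρ^{⊗n}} denotes pinching by the spectral PVM of ρ^{⊗n}. -/

import Mathlib

open Matrix Filter ComplexOrder

section Defs

variable {ι : Type*} [Fintype ι] [DecidableEq ι]

/-- Functional calculus for Hermitian matrices: apply `f` to the eigenvalues. -/
noncomputable def matCFC (f : ℝ → ℝ) (A : Matrix ι ι ℂ) : Matrix ι ι ℂ :=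
  if hA : A.IsHermitian then
    (hA.eigenvectorUnitary : Matrix ι ι ℂ) *
      Matrix.diagonal (fun i => (f (hA.eigenvalues i) : ℂ)) *
      star (hA.eigenvectorUnitary : Matrix ι ι ℂ)
  else 0

/-- Matrix logarithm by functional calculus (with the convention `log 0 = 0`,
so that `0 log 0 = 0`). -/
noncomputable def matLog (A : Matrix ι ι ℂ) : Matrix ι ι ℂ := matCFC Real.log A

/-- A state (density matrix): positive semidefinite with trace one. -/
def IsState (ρ : Matrix ι ι ℂ) : Prop := ρ.PosSemidef ∧ ρ.trace = 1

/-- Quantum relative entropy `D(σ‖ρ) = Tr[σ (log σ - log ρ)]`. -/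
noncomputable def qRelEnt (σ ρ : Matrix ι ι ℂ) : ℝ :=
  (σ * (matLog σ - matLog ρ)).trace.re

/-- A POVM: finitely many positive semidefinite matrices summing to the identity. -/
def IsPOVM {J : Type*} [Fintype J] (M : J → Matrix ι ι ℂ) : Prop :=
  (∀ j, (M j).PosSemidef) ∧ ∑ j, M j = 1

/-- A PVM: a POVM consisting of mutually orthogonal projections. -/
def IsPVM {J : Type*} [Fintype J] (M : J → Matrix ι ι ℂ) : Prop :=
  IsPOVM M ∧ (∀ j, (M j).IsHermitian ∧ M j * M j = M j) ∧
    ∀ j j', j ≠ j' → M j * M j' = 0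

/-- Kullback–Leibler divergence of finite probability vectors
(with the convention `0 log 0 = 0`, using `Real.log 0 = 0`). -/
noncomputable def klDiv {J : Type*} [Fintype J] (p q : J → ℝ) : ℝ :=
  ∑ j, p j * Real.log (p j / q j)

/-- The outcome probability `Tr[M ρ]` of a POVM element `M` in the state `ρ`. -/
noncomputable def probOf (M ρ : Matrix ι ι ℂ) : ℝ := (M * ρ).trace.re

/-- `D_M(σ‖ρ)`: the KL divergence of the outcome distributions of a POVM `M`. -/
noncomputable def Dm {J : Type*} [Fintype J] (M : J → Matrix ι ι ℂ)
    (σ ρ : Matrix ι ι ℂ) : ℝ :=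
  klDiv (fun j => probOf (M j) σ) (fun j => probOf (M j) ρ)

/-- A PVM `F` refines a family `E` if every member of `E` is a sum of some members of `F`. -/
def Refines {J K : Type*} [Fintype J] (F : J → Matrix ι ι ℂ) (E : K → Matrix ι ι ℂ) : Prop :=
  ∀ i, ∃ S : Finset J, E i = ∑ j ∈ S, F j

/-- The set of eigenvalues of a Hermitian matrix, as a finite set of reals. -/
noncomputable def spectrumFinset (A : Matrix ι ι ℂ) : Finset ℝ :=
  letI := Classical.decEq ℝ
  if hA : A.IsHermitian then Finset.image hA.eigenvalues Finset.univ else ∅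

/-- The eigenprojection of a Hermitian matrix `A` for the eigenvalue `c`. -/
noncomputable def eigProj (A : Matrix ι ι ℂ) (c : ℝ) : Matrix ι ι ℂ :=
  letI := Classical.decEq ℝ
  matCFC (fun x => if x = c then 1 else 0) A

/-- `F` refines the spectral PVM `E(ρ)` of `ρ`: every eigenprojection of `ρ`
is a sum of some members of `F`. -/
def RefinesSpectral {J : Type*} [Fintype J] (F : J → Matrix ι ι ℂ)
    (ρ : Matrix ι ι ℂ) : Prop :=
  ∀ c ∈ spectrumFinset ρ, ∃ S : Finset J, eigProj ρ c = ∑ j ∈ S, F j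

/-- The pinching (conditional expectation) `𝓔_F(σ) = Σ_j F_j σ F_j` of `σ` by a PVM `F`. -/
noncomputable def pinchPVM {J : Type*} [Fintype J] (F : J → Matrix ι ι ℂ)
    (σ : Matrix ι ι ℂ) : Matrix ι ι ℂ :=
  ∑ j, F j * σ * F j

/-- The pinching `𝓔_τ(σ)` of `σ` by the spectral PVM of `τ`. -/
noncomputable def spectralPinch (τ σ : Matrix ι ι ℂ) : Matrix ι ι ℂ :=
  ∑ c ∈ spectrumFinset τ, eigProj τ c * σ * eigProj τ c

/-- The support of a matrix, i.e. the range of the associated linear map. -/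
noncomputable def matSupp (A : Matrix ι ι ℂ) : Submodule ℂ (ι → ℂ) := LinearMap.range A.mulVecLin

end Defs

/-- The `n`-fold tensor (Kronecker) power `A^{⊗n}` of a `k × k` matrix,
acting on `(ℂ^k)^{⊗n}`. -/
noncomputable def tensPow {k : ℕ} (n : ℕ) (A : Matrix (Fin k) (Fin k) ℂ) :
    Matrix (Fin n → Fin k) (Fin n → Fin k) ℂ :=
  Matrix.of fun x y => ∏ i, A (x i) (y i)

section Aux

variable {ι : Type*} [Fintype ι] [DecidableEq ι]

lemma matCFC_eq_cfc (f : ℝ → ℝ) {A : Matrix ι ι ℂ} (hA : A.IsHermitian) :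
    matCFC f A = cfc f A := by
  rw [hA.cfc_eq, matCFC, dif_pos hA, Matrix.IsHermitian.cfc, Unitary.conjStarAlgAut_apply]
  rfl

/-- Core scalar estimate. -/
lemma core_bounds (l m : ι → ℝ) (hl : ∀ a, 0 ≤ l a) (hm : ∀ b, 0 ≤ m b)
    (W : Matrix ι ι ℂ) (v : ℝ) (hv : 0 < v)
    (hrow : ∀ a, ∑ b, ‖W a b‖ ^ 2 = 1) (hcol : ∀ b, ∑ a, ‖W a b‖ ^ 2 = 1)
    (H : ∀ (z : ι → ℂ) (a : ι), l a * ‖(W *ᵥ z) a‖ ^ 2 ≤ v * ∑ b, m b * ‖z b‖ ^ 2) :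
    (∑ a, l a - ∑ b, m b ≤
      ∑ a, ∑ b, l a * (Real.log (l a) - Real.log (m b)) * ‖W a b‖ ^ 2) ∧
    (∑ a, ∑ b, l a * (Real.log (l a) - Real.log (m b)) * ‖W a b‖ ^ 2 ≤
      Real.log v * ∑ a, l a) := by
  have supp : ∀ a b, m b = 0 → l a * ‖W a b‖ ^ 2 = 0 := by
    intro a b hb
    have h1 := H (Pi.single b 1) a
    have h2 : ∑ b', m b' * ‖(Pi.single b 1 : ι → ℂ) b'‖ ^ 2 = 0 := by
      apply Finset.sum_eq_zero
      intro b' _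
      by_cases hbb : b' = b
      · subst hbb; simp [hb]
      · simp [hbb]
    rw [h2] at h1
    simp at h1
    exact le_antisymm h1 (mul_nonneg (hl a) (by positivity))
  constructor
  · have e1 : ∑ a, l a - ∑ b, m b = ∑ a, ∑ b, (l a - m b) * ‖W a b‖ ^ 2 := by
      simp only [sub_mul, Finset.sum_sub_distrib]
      congr 1
      · simp [← Finset.mul_sum, hrow]
      · rw [Finset.sum_comm]
        simp [← Finset.mul_sum, hcol]
    rw [e1]
    refine Finset.sum_le_sum fun a _ => Finset.sum_le_sum fun b _ => ?_
    rcases (hm b).eq_or_lt with hb | hb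
    · have := supp a b hb.symm
      rw [← hb]
      have : l a * (Real.log (l a) - Real.log 0) * ‖W a b‖ ^ 2 =
        (Real.log (l a) - Real.log 0) * (l a * ‖W a b‖ ^ 2) := by ring
      rw [this, supp a b hb.symm, sub_zero, supp a b hb.symm]; simp
    · refine mul_le_mul_of_nonneg_right ?_ (by positivity)
      rcases (hl a).eq_or_lt with ha | ha
      · rw [← ha]; simp [hm b]
      · have h3 := Real.log_le_sub_one_of_pos (div_pos hb ha)
        rw [Real.log_div hb.ne' ha.ne'] at h3
        have h4 := mul_le_mul_of_nonneg_left h3 ha.le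
        have h5 : l a * (m b / l a - 1) = m b - l a := by field_simp
        rw [h5] at h4
        linarith
  · rw [Finset.mul_sum]
    refine Finset.sum_le_sum fun a _ => ?_
    rcases (hl a).eq_or_lt with ha | ha
    · rw [← ha]; simp
    have w0 : ∀ b, m b = 0 → ‖W a b‖ ^ 2 = 0 := fun b hb =>
      (mul_eq_zero.mp (supp a b hb)).resolve_left ha.ne'
    set t : ℝ := ∑ b, ‖W a b‖ ^ 2 * (m b)⁻¹ with ht
    have ht0 : 0 ≤ t := Finset.sum_nonneg fun b _ =>
      mul_nonneg (by positivity) (inv_nonneg.mpr (hm b))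
    have key : l a * t ≤ v := by
      have h1 := H (fun b => star (W a b) * ((m b)⁻¹ : ℝ)) a
      have e1 : (W *ᵥ (fun b => star (W a b) * ((m b)⁻¹ : ℝ))) a = (t : ℂ) := by
        simp only [Matrix.mulVec, dotProduct, ht]
        push_cast
        refine Finset.sum_congr rfl fun b _ => ?_
        rw [← mul_assoc]
        congr 1
        exact Complex.mul_conj' (W a b)
      have e2 : ∑ b, m b * ‖star (W a b) * (((m b)⁻¹ : ℝ) : ℂ)‖ ^ 2 = t := by
        refine Finset.sum_congr rfl fun b _ => ?_
        rw [norm_mul, norm_star, Complex.norm_real, mul_pow, Real.norm_eq_abs, sq_abs]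
        rcases (hm b).eq_or_lt with hb | hb
        · rw [← hb]; simp
        · field_simp
      rw [e1, e2, Complex.norm_real, Real.norm_eq_abs, sq_abs] at h1
      rcases ht0.eq_or_lt with h0 | h0
      · rw [← h0]; simp [hv.le]
      · nlinarith
    have step : ∀ b, l a * (Real.log (l a) - Real.log (m b)) * ‖W a b‖ ^ 2 ≤
        l a * (l a / v * (‖W a b‖ ^ 2 * (m b)⁻¹) + (Real.log v - 1) * ‖W a b‖ ^ 2) := by
      intro b
      rcases (hm b).eq_or_lt with hb | hb
      · rw [w0 b hb.symm]; simp
      · have h3 := Real.log_le_sub_one_of_pos (div_pos ha (mul_pos hv hb))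
        rw [Real.log_div ha.ne' (mul_pos hv hb).ne', Real.log_mul hv.ne' hb.ne'] at h3
        rw [mul_assoc]
        refine mul_le_mul_of_nonneg_left ?_ ha.le
        have h4 : Real.log (l a) - Real.log (m b) ≤ l a / (v * m b) + (Real.log v - 1) := by
          linarith
        have h5 := mul_le_mul_of_nonneg_right h4 (by positivity : 0 ≤ ‖W a b‖ ^ 2)
        refine h5.trans (le_of_eq ?_)
        field_simp
    refine (Finset.sum_le_sum fun b _ => step b).trans ?_
    rw [← Finset.mul_sum, Finset.sum_add_distrib, ← Finset.mul_sum, ← Finset.mul_sum, hrow,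
      ← ht, mul_comm (Real.log v)]
    refine mul_le_mul_of_nonneg_left ?_ ha.le
    have : l a / v * t ≤ 1 := by
      rw [div_mul_eq_mul_div, div_le_one hv]; exact key
    linarith

lemma trace_diag_aux (U V : Matrix ι ι ℂ) (x y : ι → ℝ) :
    (U * Matrix.diagonal (fun i => (x i : ℂ)) * star U *
      (V * Matrix.diagonal (fun i => (y i : ℂ)) * star V)).trace =
      ((∑ a, ∑ b, x a * y b * ‖(star U * V) a b‖ ^ 2 : ℝ) : ℂ) := by
  have h1 : (U * Matrix.diagonal (fun i => (x i : ℂ)) * star U *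
      (V * Matrix.diagonal (fun i => (y i : ℂ)) * star V)).trace =
      (Matrix.diagonal (fun i => (x i : ℂ)) * ((star U * V) *
        Matrix.diagonal (fun i => (y i : ℂ)) * star (star U * V))).trace := by
    rw [star_mul, star_star, mul_assoc, mul_assoc, Matrix.trace_mul_comm]
    simp only [mul_assoc]
  rw [h1]
  generalize star U * V = W
  simp only [Matrix.trace, Matrix.diag_apply, Matrix.diagonal_mul]
  push_cast
  refine Finset.sum_congr rfl fun a _ => ?_
  rw [Matrix.mul_apply, Finset.mul_sum]
  refine Finset.sum_congr rfl fun b _ => ?_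
  rw [Matrix.mul_diagonal, Matrix.star_apply, ← Complex.mul_conj' (W a b), starRingEnd_apply]
  ring

lemma quad_diag_aux (U : Matrix ι ι ℂ) (x : ι → ℝ) (z : ι → ℂ) :
    star z ⬝ᵥ ((U * Matrix.diagonal (fun i => (x i : ℂ)) * star U) *ᵥ z) =
      ((∑ a, x a * ‖(star U *ᵥ z) a‖ ^ 2 : ℝ) : ℂ) := by
  rw [mul_assoc, ← Matrix.mulVec_mulVec, ← Matrix.mulVec_mulVec, Matrix.dotProduct_mulVec]
  have : star z ᵥ* U = star (star U *ᵥ z) := by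
    rw [Matrix.star_mulVec, Matrix.star_eq_conjTranspose, Matrix.conjTranspose_conjTranspose]
  rw [this]
  generalize star U *ᵥ z = y
  simp only [dotProduct, Matrix.mulVec_diagonal, Pi.star_apply]
  push_cast
  refine Finset.sum_congr rfl fun a _ => ?_
  rw [← Complex.mul_conj' (y a), starRingEnd_apply]
  ring

lemma unitary_row {W : Matrix ι ι ℂ} (hW : W * star W = 1) (a : ι) :
    ∑ b, ‖W a b‖ ^ 2 = 1 := by
  have := congrFun (congrFun hW a) a
  rw [Matrix.mul_apply, Matrix.one_apply_eq] at this
  have h2 : ((∑ b, ‖W a b‖ ^ 2 : ℝ) : ℂ) = 1 := by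
    rw [← this]; push_cast
    refine Finset.sum_congr rfl fun b _ => ?_
    rw [Matrix.star_apply, ← Complex.mul_conj' (W a b), starRingEnd_apply]
  exact_mod_cast h2

lemma spectral_form {A : Matrix ι ι ℂ} (hA : A.IsHermitian) :
    A = (hA.eigenvectorUnitary : Matrix ι ι ℂ) *
      Matrix.diagonal (fun i => (hA.eigenvalues i : ℂ)) *
      star (hA.eigenvectorUnitary : Matrix ι ι ℂ) := by
  conv_lhs => rw [hA.spectral_theorem, Unitary.conjStarAlgAut_apply]
  rfl

lemma relent_bounds {s w : Matrix ι ι ℂ} (hs : s.PosSemidef) (hw : w.PosSemidef)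
    (v : ℝ) (hv : 0 < v)
    (H : ∀ z : ι → ℂ, (star z ⬝ᵥ (s *ᵥ z)).re ≤ v * (star z ⬝ᵥ (w *ᵥ z)).re) :
    s.trace.re - w.trace.re ≤ qRelEnt s w ∧ qRelEnt s w ≤ Real.log v * s.trace.re := by
  set U : Matrix ι ι ℂ := (hs.1.eigenvectorUnitary : Matrix ι ι ℂ) with hU
  set V : Matrix ι ι ℂ := (hw.1.eigenvectorUnitary : Matrix ι ι ℂ) with hV
  have U1 : star U * U = 1 := Unitary.coe_star_mul_self _
  have U2 : U * star U = 1 := Unitary.coe_mul_star_self _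
  have V1 : star V * V = 1 := Unitary.coe_star_mul_self _
  have V2 : V * star V = 1 := Unitary.coe_mul_star_self _
  set l := hs.1.eigenvalues with hl
  set m := hw.1.eigenvalues with hm
  have es : s = U * Matrix.diagonal (fun i => (l i : ℂ)) * star U := spectral_form hs.1
  have ew : w = V * Matrix.diagonal (fun i => (m i : ℂ)) * star V := spectral_form hw.1
  have els : matLog s = U * Matrix.diagonal (fun i => (Real.log (l i) : ℂ)) * star U := by
    rw [matLog, matCFC, dif_pos hs.1]
  have elw : matLog w = V * Matrix.diagonal (fun i => (Real.log (m i) : ℂ)) * star V := by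
    rw [matLog, matCFC, dif_pos hw.1]
  have hrow : ∀ a, ∑ b, ‖(star U * V) a b‖ ^ 2 = 1 := by
    apply unitary_row
    rw [star_mul, star_star, mul_assoc, ← mul_assoc V, V2, one_mul, U1]
  have hcol : ∀ b, ∑ a, ‖(star U * V) a b‖ ^ 2 = 1 := by
    intro b
    have h1 : star V * U * star (star V * U) = 1 := by
      rw [star_mul, star_star, mul_assoc, ← mul_assoc U, U2, one_mul, V1]
    rw [← unitary_row h1 b]
    refine Finset.sum_congr rfl fun a _ => ?_
    have : (star V * U) b a = star ((star U * V) a b) := by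
      rw [← Matrix.star_apply, star_mul, star_star]
    rw [this, norm_star]
  have core := core_bounds l m (fun a => hs.eigenvalues_nonneg a)
    (fun a => hw.eigenvalues_nonneg a) (star U * V) v hv hrow hcol (by
      intro z a
      have h1 := H (V *ᵥ z)
      rw [es, ew, quad_diag_aux, quad_diag_aux, Complex.ofReal_re, Complex.ofReal_re,
        Matrix.mulVec_mulVec, Matrix.mulVec_mulVec, V1, Matrix.one_mulVec] at h1
      refine le_trans ?_ h1
      exact Finset.single_le_sum (f := fun a => l a * ‖((star U * V) *ᵥ z) a‖ ^ 2)
        (fun i _ => mul_nonneg (hs.eigenvalues_nonneg i) (by positivity)) (Finset.mem_univ a))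
  have ts : s.trace.re = ∑ a, l a := by
    rw [hs.1.trace_eq_sum_eigenvalues]; simp [hl]
  have tw : w.trace.re = ∑ a, m a := by
    rw [hw.1.trace_eq_sum_eigenvalues]; simp [hm]
  have t1 : (s * matLog s).trace = ((∑ a, ∑ b, l a * Real.log (l a) *
      ‖(star U * V) a b‖ ^ 2 : ℝ) : ℂ) := by
    rw [els]
    conv_lhs => rw [es]
    rw [trace_diag_aux, U1]
    congr 1
    refine Finset.sum_congr rfl fun a _ => ?_
    rw [← Finset.mul_sum, hrow, Finset.sum_eq_single a]
    · simp
    · intro b _ hb; simp [Matrix.one_apply_ne hb.symm]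
    · simp
  have t2 : (s * matLog w).trace = ((∑ a, ∑ b, l a * Real.log (m b) *
      ‖(star U * V) a b‖ ^ 2 : ℝ) : ℂ) := by
    rw [elw]
    conv_lhs => rw [es]
    rw [trace_diag_aux]
  have tq : qRelEnt s w = ∑ a, ∑ b, l a * (Real.log (l a) - Real.log (m b)) *
      ‖(star U * V) a b‖ ^ 2 := by
    rw [qRelEnt, mul_sub, Matrix.trace_sub, t1, t2, ← Complex.ofReal_sub, Complex.ofReal_re]
    simp only [← Finset.sum_sub_distrib]
    refine Finset.sum_congr rfl fun a _ => Finset.sum_congr rfl fun b _ => ?_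
    ring
  rw [tq, ts, tw]
  exact core

lemma quad_nonneg {s : Matrix ι ι ℂ} (hs : s.PosSemidef) (z : ι → ℂ) :
    0 ≤ (star z ⬝ᵥ (s *ᵥ z)).re :=
  (Complex.nonneg_iff.mp (hs.dotProduct_mulVec_nonneg z)).1

lemma quad_sum_le {κ : Type*} (S : Finset κ) {s : Matrix ι ι ℂ} (hs : s.PosSemidef)
    (z : κ → ι → ℂ) :
    (star (∑ c ∈ S, z c) ⬝ᵥ (s *ᵥ (∑ c ∈ S, z c))).re ≤
      S.card * ∑ c ∈ S, (star (z c) ⬝ᵥ (s *ᵥ z c)).re := by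
  rw [spectral_form hs.1]
  simp only [quad_diag_aux, Complex.ofReal_re]
  rw [Finset.sum_comm, Finset.mul_sum]
  refine Finset.sum_le_sum fun a _ => ?_
  rw [← Finset.mul_sum, mul_left_comm]
  refine mul_le_mul_of_nonneg_left ?_ (hs.eigenvalues_nonneg a)
  rw [Matrix.mulVec_sum, Finset.sum_apply]
  refine le_trans ?_ sq_sum_le_card_mul_sum_sq
  exact pow_le_pow_left₀ (norm_nonneg _) (norm_sum_le _ _) 2

section Pinch

variable {t : Matrix ι ι ℂ}

lemma cont_any (_ht : t.IsHermitian) (f : ℝ → ℝ) : ContinuousOn f (spectrum ℝ t) :=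
  (Matrix.finite_real_spectrum (A := t)).continuousOn f

open Classical in
lemma eigProj_eq (ht : t.IsHermitian) (c : ℝ) : eigProj t c = cfc (fun x : ℝ => if x = c then (1:ℝ) else 0) t := by
  rw [eigProj, matCFC_eq_cfc _ ht]

lemma eigProj_herm (ht : t.IsHermitian) (c : ℝ) : (eigProj t c)ᴴ = eigProj t c := by
  rw [eigProj_eq ht]
  exact cfc_predicate (R := ℝ) (p := IsSelfAdjoint) _ t

lemma eigProj_mul_self (ht : t.IsHermitian) (c : ℝ) : eigProj t c * eigProj t c = eigProj t c := by
  classical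
  rw [eigProj_eq ht, ← cfc_mul _ _ t (cont_any ht _) (cont_any ht _)]
  congr 1; ext x; simp

lemma eigProj_mul_ne (ht : t.IsHermitian) {c c' : ℝ} (h : c ≠ c') : eigProj t c * eigProj t c' = 0 := by
  classical
  rw [eigProj_eq ht, eigProj_eq ht, ← cfc_mul _ _ t (cont_any ht _) (cont_any ht _)]
  have : (fun x : ℝ => (if x = c then (1:ℝ) else 0) * (if x = c' then (1:ℝ) else 0)) =
      fun _ => 0 := by
    ext x
    by_cases hx : x = c
    · subst hx; simp [h]
    · simp [hx]
  rw [this, cfc_const_zero]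

lemma eigProj_sum (ht : t.IsHermitian) : ∑ c ∈ spectrumFinset t, eigProj t c = 1 := by
  classical
  simp only [eigProj_eq ht]
  rw [← cfc_sum _ t _ (fun i _ => cont_any ht _)]
  have h1 : cfc (1 : ℝ → ℝ) t = 1 := cfc_one ℝ t ht
  rw [← h1]
  apply cfc_congr
  intro x hx
  rw [ht.spectrum_real_eq_range_eigenvalues] at hx
  have : x ∈ spectrumFinset t := by
    rw [spectrumFinset, dif_pos ht]
    obtain ⟨i, rfl⟩ := hx
    simp
  simp [Finset.sum_apply, this]

lemma eigProj_comm_log (ht : t.IsHermitian) (c : ℝ) : Commute (eigProj t c) (matLog t) := by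
  rw [eigProj_eq ht, matLog, matCFC_eq_cfc _ ht]
  exact cfc_commute_cfc _ _ t

lemma pinch_psd (ht : t.IsHermitian) {s : Matrix ι ι ℂ} (hs : s.PosSemidef) : (spectralPinch t s).PosSemidef := by
  rw [spectralPinch]
  refine Matrix.posSemidef_sum _ fun c _ => ?_
  have := hs.mul_mul_conjTranspose_same (eigProj t c)
  rwa [eigProj_herm ht] at this

lemma eigProj_comm_pinch (ht : t.IsHermitian) (s : Matrix ι ι ℂ) {c : ℝ} (hc : c ∈ spectrumFinset t) :
    Commute (eigProj t c) (spectralPinch t s) := by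
  have h1 : eigProj t c * spectralPinch t s = eigProj t c * s * eigProj t c := by
    rw [spectralPinch, Finset.mul_sum, Finset.sum_eq_single c]
    · rw [← mul_assoc, ← mul_assoc, eigProj_mul_self ht]
    · intro c' _ h
      rw [← mul_assoc, ← mul_assoc, eigProj_mul_ne ht h.symm]; simp
    · intro h; exact absurd hc h
  have h2 : spectralPinch t s * eigProj t c = eigProj t c * s * eigProj t c := by
    rw [spectralPinch, Finset.sum_mul, Finset.sum_eq_single c]
    · rw [mul_assoc, eigProj_mul_self ht]
    · intro c' _ h
      rw [mul_assoc, eigProj_mul_ne ht h]; simp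
    · intro h; exact absurd hc h
  exact h1.trans h2.symm

lemma trace_pinch_mul (ht : t.IsHermitian) (s X : Matrix ι ι ℂ)
    (hX : ∀ c ∈ spectrumFinset t, Commute (eigProj t c) X) :
    (spectralPinch t s * X).trace = (s * X).trace := by
  rw [spectralPinch, Finset.sum_mul, Matrix.trace_sum]
  have h1 : ∀ c ∈ spectrumFinset t, (eigProj t c * s * eigProj t c * X).trace =
      (s * X * eigProj t c).trace := by
    intro c hc
    rw [mul_assoc, mul_assoc, Matrix.trace_mul_comm, mul_assoc, mul_assoc, (hX c hc).eq.symm,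
      ← mul_assoc (eigProj t c), eigProj_mul_self ht, (hX c hc).eq, mul_assoc]
  rw [Finset.sum_congr rfl h1, ← Matrix.trace_sum, ← Finset.mul_sum, eigProj_sum ht, mul_one]

lemma pinch_ineq (ht : t.IsHermitian) {s : Matrix ι ι ℂ} (hs : s.PosSemidef) (z : ι → ℂ) :
    (star z ⬝ᵥ (s *ᵥ z)).re ≤
      (spectrumFinset t).card * (star z ⬝ᵥ (spectralPinch t s *ᵥ z)).re := by
  have h1 := quad_sum_le (spectrumFinset t) hs (fun c => eigProj t c *ᵥ z)
  have h2 : ∑ c ∈ spectrumFinset t, eigProj t c *ᵥ z = z := by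
    rw [← Matrix.sum_mulVec, eigProj_sum ht, Matrix.one_mulVec]
  rw [h2] at h1
  refine h1.trans (le_of_eq ?_)
  congr 1
  rw [spectralPinch, Matrix.sum_mulVec, dotProduct_sum, Complex.re_sum]
  refine Finset.sum_congr rfl fun c _ => ?_
  rw [Matrix.star_mulVec, eigProj_herm ht, ← Matrix.dotProduct_mulVec, Matrix.mulVec_mulVec,
    Matrix.mulVec_mulVec, mul_assoc]

lemma pinch_bounds (ht : t.IsHermitian) {s : Matrix ι ι ℂ} (hs : IsState s) (v : ℝ) (hv : 0 < v)
    (hcard : ((spectrumFinset t).card : ℝ) ≤ v) :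
    qRelEnt (spectralPinch t s) t ≤ qRelEnt s t ∧
    qRelEnt s t - Real.log v ≤ qRelEnt (spectralPinch t s) t := by
  have hw := pinch_psd ht hs.1
  have hb := relent_bounds hs.1 hw v hv (fun z => (pinch_ineq ht hs.1 z).trans
    (mul_le_mul_of_nonneg_right hcard (quad_nonneg hw z)))
  have htr : (spectralPinch t s).trace = s.trace := by
    have := trace_pinch_mul ht s 1 (fun c _ => Commute.one_right _)
    simpa using this
  have e1 := trace_pinch_mul ht s (matLog t) (fun c _ => eigProj_comm_log ht c)
  have e2 := trace_pinch_mul ht s (matLog (spectralPinch t s)) (fun c hc => by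
    rw [matLog, matCFC_eq_cfc _ hw.1]
    exact ((eigProj_comm_pinch ht s hc).symm.cfc_real _).symm)
  have e3 : qRelEnt s t - qRelEnt (spectralPinch t s) t = qRelEnt s (spectralPinch t s) := by
    simp only [qRelEnt, mul_sub, Matrix.trace_sub, e1, e2, Complex.sub_re]
    ring
  rw [htr, hs.2, ← e3] at hb
  simp at hb
  constructor
  · linarith [hb.1]
  · linarith [hb.2]

end Pinch

end Aux

section Tens

variable {d : ℕ}

lemma tensPow_mul (n : ℕ) (A B : Matrix (Fin d) (Fin d) ℂ) :
    tensPow n (A * B) = tensPow n A * tensPow n B := by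
  ext x y
  simp only [tensPow, Matrix.of_apply, Matrix.mul_apply]
  rw [Finset.prod_univ_sum]
  simp [Fintype.piFinset_univ, Finset.prod_mul_distrib]

lemma tensPow_star (n : ℕ) (A : Matrix (Fin d) (Fin d) ℂ) :
    tensPow n (star A) = star (tensPow n A) := by
  ext x y
  simp [tensPow, Matrix.star_apply]

lemma tensPow_diagonal (n : ℕ) (f : Fin d → ℂ) :
    tensPow n (Matrix.diagonal f) = Matrix.diagonal (fun x : Fin n → Fin d => ∏ i, f (x i)) := by
  ext x y
  by_cases h : x = y
  · subst h; simp [tensPow]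
  · rw [Matrix.diagonal_apply_ne _ h]
    obtain ⟨i, hi⟩ := Function.ne_iff.mp h
    simp only [tensPow, Matrix.of_apply]
    exact Finset.prod_eq_zero (Finset.mem_univ i) (Matrix.diagonal_apply_ne _ hi)

lemma tensPow_one (n : ℕ) : tensPow n (1 : Matrix (Fin d) (Fin d) ℂ) = 1 := by
  rw [← Matrix.diagonal_one, tensPow_diagonal]; simp

lemma card_spec_le (n : ℕ) {A : Matrix (Fin d) (Fin d) ℂ} (hA : A.IsHermitian) :
    (spectrumFinset (tensPow n A)).card ≤ (n + 1) ^ d := by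
  classical
  have hT : (tensPow n A).IsHermitian := by
    have : star (tensPow n A) = tensPow n A := by
      rw [← tensPow_star, Matrix.star_eq_conjTranspose, hA.eq]
    exact this
  set U : Matrix (Fin d) (Fin d) ℂ := (hA.eigenvectorUnitary : Matrix (Fin d) (Fin d) ℂ) with hU
  have U1 : star U * U = 1 := Unitary.coe_star_mul_self _
  have U2 : U * star U = 1 := Unitary.coe_mul_star_self _
  have hUn : tensPow n U ∈ unitary (Matrix (Fin n → Fin d) (Fin n → Fin d) ℂ) := by
    rw [Unitary.mem_iff, ← tensPow_star, ← tensPow_mul, ← tensPow_mul, U1, U2, tensPow_one]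
    simp
  have e : tensPow n A = tensPow n U * Matrix.diagonal
      (fun x : Fin n → Fin d => ∏ i, (hA.eigenvalues (x i) : ℂ)) * star (tensPow n U) := by
    rw [← tensPow_diagonal n (fun i => (hA.eigenvalues i : ℂ)), ← tensPow_star, ← tensPow_mul,
      ← tensPow_mul, ← spectral_form hA]
  have hsub : spectrumFinset (tensPow n A) ⊆ Finset.image
      (fun k : Fin d → Fin (n + 1) => ∏ j, hA.eigenvalues j ^ (k j : ℕ)) Finset.univ := by
    intro c hc
    rw [spectrumFinset, dif_pos hT] at hc
    have hc2 : c ∈ spectrum ℝ (tensPow n A) := by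
      rw [hT.spectrum_real_eq_range_eigenvalues]
      simpa using hc
    have hc3 : (c : ℂ) ∈ spectrum ℂ (tensPow n A) :=
      (spectrum.algebraMap_mem_iff ℂ (R := ℝ) (r := c)).mpr hc2
    have hsp := Unitary.spectrum_star_right_conjugate (R := ℂ) (U := ⟨tensPow n U, hUn⟩)
      (a := Matrix.diagonal (fun x : Fin n → Fin d => ∏ i, (hA.eigenvalues (x i) : ℂ)))
    rw [e] at hc3
    simp only at hsp
    rw [hsp, spectrum_diagonal] at hc3
    obtain ⟨x, hx⟩ := hc3
    have hx' : ∏ i, hA.eigenvalues (x i) = c := by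
      simp only at hx
      exact_mod_cast hx
    rw [Finset.mem_image]
    refine ⟨fun j => ⟨(Finset.univ.filter (fun i => x i = j)).card, ?_⟩, Finset.mem_univ _, ?_⟩
    · refine Nat.lt_succ_of_le ((Finset.card_le_univ _).trans (by simp))
    · rw [← hx', ← Finset.prod_fiberwise_of_maps_to (s := Finset.univ) (t := Finset.univ)
        (g := x) (fun _ _ => Finset.mem_univ _)]
      refine Finset.prod_congr rfl fun j _ => ?_
      rw [Finset.prod_congr rfl (g := fun _ => hA.eigenvalues j), Finset.prod_const]
      intro i hi
      rw [(Finset.mem_filter.mp hi).2]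
  refine (Finset.card_le_card hsub).trans (Finset.card_image_le.trans ?_)
  simp

end Tens

/-- Hiai–Petz: If `(1/n) D(σ_n‖ρ^{⊗n})` converges, then the pinched
quantities `(1/n) D(𝓔_{ρ^{⊗n}}(σ_n)‖ρ^{⊗n})` converge to the same limit. -/
theorem statement10 (d : ℕ) (ρ : Matrix (Fin d) (Fin d) ℂ)
    (hρ : IsState ρ) (hρpd : ρ.PosDef)
    (σ : ∀ n : ℕ, Matrix (Fin n → Fin d) (Fin n → Fin d) ℂ)
    (hσ : ∀ n, IsState (σ n)) (L : ℝ)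
    (h : Tendsto (fun n : ℕ => (1 / n : ℝ) * qRelEnt (σ n) (tensPow n ρ)) atTop (nhds L)) :
    Tendsto (fun n : ℕ =>
        (1 / n : ℝ) * qRelEnt (spectralPinch (tensPow n ρ) (σ n)) (tensPow n ρ))
      atTop (nhds L) := by
  have hT : ∀ n, (tensPow n ρ).IsHermitian := fun n => by
    have : star (tensPow n ρ) = tensPow n ρ := by
      rw [← tensPow_star, Matrix.star_eq_conjTranspose, hρ.1.1.eq]
    exact this
  have hb := fun n => pinch_bounds (hT n) (hσ n) (((n : ℝ) + 1) ^ d) (by positivity)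
    (by exact_mod_cast card_spec_le n hρ.1.1)
  have hlog : Tendsto (fun n : ℕ => (1 / n : ℝ) * Real.log (((n : ℝ) + 1) ^ d)) atTop (nhds 0) := by
    have h1 : Tendsto (fun x : ℝ => Real.log x / (1 * x + (-1))) atTop (nhds 0) := by
      simpa using Real.tendsto_pow_log_div_mul_add_atTop 1 (-1) 1 one_ne_zero
    have h2 : Tendsto (fun n : ℕ => (n : ℝ) + 1) atTop atTop :=
      tendsto_atTop_add_const_right _ _ tendsto_natCast_atTop_atTop
    have h3 := (h1.comp h2).const_mul (d : ℝ)
    rw [mul_zero] at h3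
    refine h3.congr fun n => ?_
    simp only [Function.comp, Real.log_pow]
    have : 1 * ((n : ℝ) + 1) + -1 = n := by ring
    rw [this]; ring
  have hlow := h.sub hlog
  rw [sub_zero] at hlow
  refine tendsto_of_tendsto_of_tendsto_of_le_of_le hlow h (fun n => ?_) (fun n => ?_)
  · have := mul_le_mul_of_nonneg_left (hb n).2 (by positivity : (0:ℝ) ≤ 1 / n)
    simpa [mul_sub] using this
  · exact mul_le_mul_of_nonneg_left (hb n).1 (by positivity)
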